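/- arXiv:2311.16188 — 4 statements merged into one kernel-verified Lean document; each statement's English description precedes it below -/
import Mathlib

section
/- (Foliage Source Reduction) Let G = (V,E) and G' = (V',E') be finite simple graphs, let F_W be a foliage partition of V with representative set R containing one vertex from each block, and suppose V' ⊆ R ⊆ V. If G' has no isolated vertices, then G' is a vertex-minor of G if and only if G' is a vertex-minor of the foliage graph labeling F_{W,R}(G). -/
/-- A finite simple graph with an explicit vertex set `verts` inside an ambient type `V`. -/
structure FGraph (V : Type*) where
  verts : Finset V
  Adj : V → V → Prop
  symm : ∀ x y, Adj x y → Adj y x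
  loopless : ∀ x, ¬ Adj x x
  mem_of_adj : ∀ x y, Adj x y → x ∈ verts ∧ y ∈ verts

variable {V : Type*}

/-- Local complementation `τ_a(G)`: toggle every edge between distinct neighbors of `a`. -/
def FGraph.lc (G : FGraph V) (a : V) : FGraph V where
  verts := G.verts
  Adj x y := (G.Adj x y ∧ ¬(x ≠ y ∧ G.Adj a x ∧ G.Adj a y)) ∨
             ((x ≠ y ∧ G.Adj a x ∧ G.Adj a y) ∧ ¬ G.Adj x y)
  symm := by
    rintro x y (⟨h1, h2⟩ | ⟨⟨hne, hx, hy⟩, h2⟩)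
    · exact Or.inl ⟨G.symm _ _ h1, fun h => h2 ⟨h.1.symm, h.2.2, h.2.1⟩⟩
    · exact Or.inr ⟨⟨hne.symm, hy, hx⟩, fun h => h2 (G.symm _ _ h)⟩
  loopless := by
    rintro x (⟨h1, _⟩ | ⟨⟨hne, _, _⟩, _⟩)
    · exact G.loopless x h1
    · exact hne rfl
  mem_of_adj := by
    rintro x y (⟨h1, _⟩ | ⟨⟨hne, hx, hy⟩, _⟩)
    · exact G.mem_of_adj _ _ h1
    · exact ⟨(G.mem_of_adj _ _ hx).2, (G.mem_of_adj _ _ hy).2⟩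

/-- Vertex deletion `G \ v`. -/
def FGraph.delete [DecidableEq V] (G : FGraph V) (v : V) : FGraph V where
  verts := G.verts.erase v
  Adj x y := G.Adj x y ∧ x ≠ v ∧ y ≠ v
  symm := by rintro x y ⟨h, hx, hy⟩; exact ⟨G.symm _ _ h, hy, hx⟩
  loopless := by rintro x ⟨h, _⟩; exact G.loopless x h
  mem_of_adj := by
    rintro x y ⟨h, hx, hy⟩
    exact ⟨Finset.mem_erase.2 ⟨hx, (G.mem_of_adj _ _ h).1⟩,
           Finset.mem_erase.2 ⟨hy, (G.mem_of_adj _ _ h).2⟩⟩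

/-- One step: a local complementation or a vertex deletion. -/
def FGraph.Step [DecidableEq V] (G G' : FGraph V) : Prop :=
  (∃ a, G' = G.lc a) ∨ (∃ v, G' = G.delete v)

/-- `H` is a vertex-minor of `G` (written `H < G`): `H` is obtained from `G` by a finite
sequence of local complementations and vertex deletions. -/
def IsVertexMinor [DecidableEq V] (H G : FGraph V) : Prop :=
  Relation.ReflTransGen FGraph.Step G H

/-- `(l, a)` is a leaf-axil pair: `l` has degree 1 and its unique neighbor is `a`. -/
def FGraph.IsLeafAxil (G : FGraph V) (l a : V) : Prop :=
  G.Adj l a ∧ ∀ x, G.Adj l x → x = a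

/-- `v` and `w` are twins: `N_v \ {w} = N_w \ {v} ≠ ∅`. -/
def FGraph.IsTwin (G : FGraph V) (v w : V) : Prop :=
  v ≠ w ∧ {x | G.Adj v x} \ {w} = {x | G.Adj w x} \ {v} ∧
    ({x | G.Adj v x} \ {w}).Nonempty

/-- Foliage equivalence `v ∼_F w`. -/
def FGraph.FoliageEq (G : FGraph V) (v w : V) : Prop :=
  v = w ∨ G.IsLeafAxil v w ∨ G.IsLeafAxil w v ∨ G.IsTwin v w

/-- `P` is a partition of the set `S`. -/
def IsPartitionOn (P : Set (Set V)) (S : Set V) : Prop :=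
  (∀ A ∈ P, A.Nonempty) ∧ (∀ A ∈ P, A ⊆ S) ∧ (∀ v ∈ S, ∃! A, A ∈ P ∧ v ∈ A)

/-- A foliage partition of `G`: a partition of the vertex set each of whose blocks
consists of pairwise foliage-equivalent vertices. -/
def FGraph.IsFoliagePartition (G : FGraph V) (P : Set (Set V)) : Prop :=
  IsPartitionOn P ↑G.verts ∧ ∀ A ∈ P, ∀ v ∈ A, ∀ w ∈ A, G.FoliageEq v w

/-- The foliage graph labeling `F_{W,R}(G)`: the graph on the representative set `R`
where two representatives are adjacent iff their (distinct) blocks have an edge of `G`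
between them. -/
def FGraph.labeling (G : FGraph V) (P : Set (Set V)) (R : Finset V) : FGraph V where
  verts := R
  Adj x y := x ≠ y ∧ x ∈ R ∧ y ∈ R ∧
    ∃ A ∈ P, ∃ B ∈ P, A ≠ B ∧ x ∈ A ∧ y ∈ B ∧ ∃ u ∈ A, ∃ v ∈ B, G.Adj u v
  symm := by
    rintro x y ⟨hne, hx, hy, A, hA, B, hB, hAB, hxA, hyB, u, hu, v, hv, huv⟩
    exact ⟨hne.symm, hy, hx, B, hB, A, hA, hAB.symm, hyB, hxA, v, hv, u, hu, G.symm _ _ huv⟩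
  loopless := by rintro x ⟨hne, _⟩; exact hne rfl
  mem_of_adj := by rintro x y ⟨_, hx, hy, _⟩; exact ⟨hx, hy⟩

theorem FGraph.ext_adj {V : Type*} {G H : FGraph V} (h1 : G.verts = H.verts)
    (h2 : ∀ x y, G.Adj x y ↔ H.Adj x y) : G = H := by
  obtain ⟨v, A, _, _, _⟩ := G
  obtain ⟨w, B, _, _, _⟩ := H
  have h3 : A = B := by
    funext x y
    exact propext (h2 x y)
  simp only at h1
  subst h1
  subst h3
  rfl

theorem FGraph.lc_lc {V : Type*} (G : FGraph V) (a : V) : (G.lc a).lc a = G := by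
  refine FGraph.ext_adj rfl ?_
  intro x y
  have := G.loopless a
  simp only [FGraph.lc]
  by_cases h1 : G.Adj a x <;> by_cases h2 : G.Adj a y <;> by_cases h3 : G.Adj x y <;>
    by_cases h4 : x = y <;> by_cases h5 : a = x <;> by_cases h6 : a = y <;> simp_all

/-- An induced subgraph is a vertex-minor. -/
theorem isVertexMinor_of_induced {V : Type*} [DecidableEq V] (K : FGraph V) (n : ℕ) :
    ∀ H : FGraph V, (H.verts \ K.verts).card = n → K.verts ⊆ H.verts →
    (∀ x ∈ K.verts, ∀ y ∈ K.verts, (K.Adj x y ↔ H.Adj x y)) → IsVertexMinor K H := by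
  induction n with
  | zero =>
    intro H h0 hs hadj
    have hsub : H.verts ⊆ K.verts := by
      rw [Finset.card_eq_zero] at h0
      exact Finset.sdiff_eq_empty_iff_subset.1 h0
    have : H = K := by
      refine FGraph.ext_adj (Finset.Subset.antisymm hsub hs) ?_
      intro x y
      constructor
      · intro h
        have := H.mem_of_adj _ _ h
        exact (hadj x (hsub this.1) y (hsub this.2)).2 h
      · intro h
        have := K.mem_of_adj _ _ h
        exact (hadj x this.1 y this.2).1 h
    rw [this]
    exact Relation.ReflTransGen.refl
  | succ n ih =>
    intro H h0 hs hadj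
    have hne : (H.verts \ K.verts).Nonempty := by
      rw [← Finset.card_pos]; omega
    obtain ⟨v, hv⟩ := hne
    have hv' := Finset.mem_sdiff.1 hv
    refine Relation.ReflTransGen.head (b := H.delete v) (Or.inr ⟨v, rfl⟩) (ih _ ?_ ?_ ?_)
    · have : (H.delete v).verts \ K.verts = (H.verts \ K.verts).erase v := by
        simp only [FGraph.delete]
        rw [Finset.erase_sdiff_comm]
      rw [this, Finset.card_erase_of_mem hv, h0]
      rfl
    · intro x hx
      simp only [FGraph.delete]
      refine Finset.mem_erase.2 ⟨?_, hs hx⟩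
      rintro rfl
      exact hv'.2 hx
    · intro x hx y hy
      have h1 : x ≠ v := by rintro rfl; exact hv'.2 hx
      have h2 : y ≠ v := by rintro rfl; exact hv'.2 hy
      rw [hadj x hx y hy]
      simp [FGraph.delete, h1, h2]

/-- The simulation invariant: across blocks (fibres of `ρ`), `H` is the blow-up of `Q` along
the set `X`. -/
def FolInv {V : Type*} (ρ : V → V) (H Q : FGraph V) (X : Set V) : Prop :=
  ∀ x y, ρ x ≠ ρ y → (H.Adj x y ↔ x ∈ X ∧ y ∈ X ∧ Q.Adj (ρ x) (ρ y))

theorem FolInv.lc_mem {V : Type*} {ρ : V → V} {H Q : FGraph V} {X : Set V}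
    (h : FolInv ρ H Q X) {a : V} (ha : a ∈ X) :
    FolInv ρ (H.lc a) (Q.lc (ρ a))
      {x | (x ∈ X ∧ ¬ (ρ x = ρ a ∧ H.Adj a x)) ∨ (x ∉ X ∧ ρ x = ρ a ∧ H.Adj a x)} := by
  intro x y hxy
  have hne : x ≠ y := by rintro rfl; exact hxy rfl
  have hQ := Q.loopless (ρ a)
  have hxy1 := h x y hxy
  have hsymm : Q.Adj (ρ x) (ρ a) ↔ Q.Adj (ρ a) (ρ x) := ⟨Q.symm _ _, Q.symm _ _⟩
  simp only [FGraph.lc, Set.mem_ofPred_eq]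
  by_cases hx : ρ x = ρ a
  · have hy : ρ a ≠ ρ y := by rw [← hx]; exact hxy
    have h2 := h a y hy
    have hy' : ρ y ≠ ρ a := hy.symm
    rw [hx] at hxy1
    by_cases p1 : x ∈ X <;> by_cases p2 : y ∈ X <;> by_cases p3 : Q.Adj (ρ a) (ρ y) <;>
      by_cases p4 : H.Adj a x <;> simp [hx, hxy1, h2, hne, ha, hQ, hy', p1, p2, p3, p4]
  · have h1 := h a x (Ne.symm hx)
    by_cases hy : ρ y = ρ a
    · rw [hy] at hxy1
      by_cases p1 : x ∈ X <;> by_cases p2 : y ∈ X <;> by_cases p3 : Q.Adj (ρ a) (ρ x) <;>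
        by_cases p4 : H.Adj a y <;>
        simp [hy, hxy1, h1, hne, ha, hQ, hx, hsymm, p1, p2, p3, p4]
    · have h2 := h a y (Ne.symm hy)
      by_cases p1 : x ∈ X <;> by_cases p2 : y ∈ X <;>
        simp [hxy1, h1, h2, hne, ha, hx, hy, hxy, p1, p2]

theorem FolInv.lc_notMem {V : Type*} {ρ : V → V} {H Q : FGraph V} {X : Set V}
    (h : FolInv ρ H Q X) {a : V} (ha : a ∉ X) : FolInv ρ (H.lc a) Q X := by
  intro x y hxy
  have key : ¬ (H.Adj a x ∧ H.Adj a y) := by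
    rintro ⟨h1, h2⟩
    by_cases hx : ρ a = ρ x
    · exact ha ((h a y (hx ▸ hxy)).1 h2).1
    · exact ha ((h a x hx).1 h1).1
  rw [← h x y hxy]
  simp only [FGraph.lc]
  tauto

theorem FolInv.delete {V : Type*} [DecidableEq V] {ρ : V → V} {H Q : FGraph V} {X : Set V}
    (h : FolInv ρ H Q X) (v : V) : FolInv ρ (H.delete v) Q (X \ {v}) := by
  intro x y hxy
  simp only [FGraph.delete, h x y hxy, Set.mem_sdiff, Set.mem_singleton_iff]
  tauto

theorem FolInv.steps {V : Type*} [DecidableEq V] {ρ : V → V} {H K Q : FGraph V} {X : Set V}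
    (h : FolInv ρ H Q X) (hK : IsVertexMinor K H) :
    ∃ Q' X', IsVertexMinor Q' Q ∧ Q'.verts = Q.verts ∧ FolInv ρ K Q' X' := by
  induction hK with
  | refl => exact ⟨Q, X, Relation.ReflTransGen.refl, rfl, h⟩
  | tail _ hstep ih =>
    obtain ⟨Q', X', hm, hv, hi⟩ := ih
    rcases hstep with ⟨a, rfl⟩ | ⟨v, rfl⟩
    · by_cases ha : a ∈ X'
      · exact ⟨Q'.lc (ρ a), _, hm.tail (Or.inl ⟨_, rfl⟩), hv, hi.lc_mem ha⟩
      · exact ⟨Q', X', hm, hv, hi.lc_notMem ha⟩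
    · exact ⟨Q', _, hm, hv, hi.delete v⟩

/-- Pivot the bad representatives one after the other. -/
theorem FolInv.fix {V : Type*} [DecidableEq V] {ρ : V → V} {Q : FGraph V} (R : Finset V)
    (hρ : ∀ r ∈ R, ρ r = r) (S : Finset V) (hSR : S ⊆ R) :
    ∀ (H : FGraph V) (X : Set V), FolInv ρ H Q X →
    (∀ r ∈ S, r ∈ X ∨ ∃ c ∈ X, ρ c = r ∧ H.Adj r c) →
    ∃ H' X', IsVertexMinor H' H ∧ H'.verts = H.verts ∧ FolInv ρ H' Q X' ∧
      (∀ x, ρ x ∉ S → (x ∈ X ↔ x ∈ X')) ∧ ∀ r ∈ S, r ∈ X' := by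
  induction S using Finset.induction_on with
  | empty =>
    intro H X h _
    exact ⟨H, X, Relation.ReflTransGen.refl, rfl, h, fun _ _ => Iff.rfl, by simp⟩
  | insert r S hrS ih =>
    intro H X h hS
    have hSR' : S ⊆ R := fun x hx => hSR (Finset.mem_insert_of_mem hx)
    have hrr : ρ r = r := hρ r (hSR (Finset.mem_insert_self _ _))
    by_cases hrX : r ∈ X
    · obtain ⟨H', X', h1, h2, h3, h4, h5⟩ :=
        ih hSR' H X h (fun s hs => hS s (Finset.mem_insert_of_mem hs))
      refine ⟨H', X', h1, h2, h3, ?_, ?_⟩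
      · intro x hx
        exact h4 x (fun h => hx (Finset.mem_insert_of_mem h))
      · intro s hs
        rcases Finset.mem_insert.1 hs with rfl | hs
        · exact (h4 s (by rw [hrr]; exact hrS)).1 hrX
        · exact h5 s hs
    · obtain ⟨c, hc, hcr, hadj⟩ := (hS r (Finset.mem_insert_self _ _)).resolve_left hrX
      have i1 := h.lc_mem hc
      generalize hX1 : {x | (x ∈ X ∧ ¬ (ρ x = ρ c ∧ H.Adj c x)) ∨
        (x ∉ X ∧ ρ x = ρ c ∧ H.Adj c x)} = X1 at i1
      have hr1 : r ∈ X1 := by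
        rw [← hX1]
        exact Or.inr ⟨hrX, by rw [hrr, hcr], H.symm _ _ hadj⟩
      have i2 := i1.lc_mem hr1
      rw [hrr, hcr, FGraph.lc_lc] at i2
      generalize hX2 : {x | (x ∈ X1 ∧ ¬ (ρ x = r ∧ (H.lc c).Adj r x)) ∨
        (x ∉ X1 ∧ ρ x = r ∧ (H.lc c).Adj r x)} = X2 at i2
      have e1 : ∀ x, ρ x ≠ r → (x ∈ X ↔ x ∈ X1) := by
        intro x hx
        rw [← hX1]
        simp [hcr, hx]
      have e2 : ∀ x, ρ x ≠ r → (x ∈ X ↔ x ∈ X2) := by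
        intro x hx
        rw [e1 x hx, ← hX2]
        simp [hx]
      have hr2 : r ∈ X2 := by
        rw [← hX2]
        exact Or.inl ⟨hr1, fun h => (H.lc c).loopless _ h.2⟩
      obtain ⟨H', X', h1, h2, h3, h4, h5⟩ := ih hSR' ((H.lc c).lc r) X2 i2 (by
        intro s hs
        have hsr : s ≠ r := by rintro rfl; exact hrS hs
        have hss : ρ s = s := hρ s (hSR' hs)
        by_cases hsX : s ∈ X
        · exact Or.inl ((e2 s (by rwa [hss])).1 hsX)
        · right
          obtain ⟨d, hd, hds, hsd⟩ :=
            (hS s (Finset.mem_insert_of_mem hs)).resolve_left hsX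
          refine ⟨d, (e2 d (by rwa [hds])).1 hd, hds, ?_⟩
          have n1 : ¬ H.Adj c s := by
            intro hh
            exact hsX ((h c s (by rw [hcr, hss]; exact hsr.symm)).1 hh).2.1
          have n2 : ¬ (H.lc c).Adj r s := by
            intro hh
            have := ((i1 r s (by rw [hrr, hss]; exact hsr.symm)).1 hh).2.1
            exact hsX ((e1 s (by rwa [hss])).2 this)
          have a1 : (H.lc c).Adj s d := Or.inl ⟨hsd, fun hh => n1 hh.2.1⟩
          exact Or.inl ⟨a1, fun hh => n2 hh.2.1⟩)
      refine ⟨H', X', ?_, h2, h3, ?_, ?_⟩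
      · exact Relation.ReflTransGen.head (Or.inl ⟨c, rfl⟩)
          (Relation.ReflTransGen.head (Or.inl ⟨r, rfl⟩) h1)
      · intro x hx
        rw [Finset.mem_insert, not_or] at hx
        rw [e2 x hx.1, h4 x hx.2]
      · intro s hs
        rcases Finset.mem_insert.1 hs with rfl | hs
        · exact (h4 s (by rw [hrr]; exact hrS)).1 hr2
        · exact h5 s hs

/-- The block map of a foliage partition. -/
theorem exists_blockMap {V : Type*} [DecidableEq V] (G : FGraph V)
    (P : Set (Set V)) (hP : G.IsFoliagePartition P) (R : Finset V)
    (hR1 : ∀ A ∈ P, ∃! w, w ∈ A ∧ w ∈ R) (hRV : R ⊆ G.verts) :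
    ∃ ρ : V → V, (∀ x ∈ G.verts, ρ x ∈ R) ∧ (∀ r ∈ R, ρ r = r) ∧
      (∀ x ∈ G.verts, ∀ y ∈ G.verts, ρ x = ρ y → G.FoliageEq x y) ∧
      (∀ p q, (G.labeling P R).Adj p q ↔
        p ≠ q ∧ ∃ u v, ρ u = p ∧ ρ v = q ∧ G.Adj u v) := by
  obtain ⟨⟨-, hsub, hex⟩, hfol⟩ := hP
  have huniq : ∀ A ∈ P, ∀ B ∈ P, ∀ x, x ∈ A → x ∈ B → A = B := by
    intro A hA B hB x hxA hxB
    exact (hex x (hsub A hA hxA)).unique ⟨hA, hxA⟩ ⟨hB, hxB⟩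
  have hch : ∀ x, ∃ r, x ∈ G.verts → r ∈ R ∧ ∃ A ∈ P, x ∈ A ∧ r ∈ A := by
    intro x
    by_cases hx : x ∈ G.verts
    · obtain ⟨A, ⟨hA, hxA⟩, -⟩ := hex x hx
      obtain ⟨r, ⟨hrA, hrR⟩, -⟩ := hR1 A hA
      exact ⟨r, fun _ => ⟨hrR, A, hA, hxA, hrA⟩⟩
    · exact ⟨x, fun h => absurd h hx⟩
  choose ρ hρ using hch
  have hblk : ∀ A ∈ P, ∀ x ∈ A, ρ x ∈ A := by
    intro A hA x hx
    obtain ⟨-, B, hB, hxB, hr⟩ := hρ x (hsub A hA hx)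
    rwa [huniq A hA B hB x hx hxB]
  have hid : ∀ r ∈ R, ρ r = r := by
    intro r hr
    obtain ⟨h1, A, hA, h2, h3⟩ := hρ r (hRV hr)
    exact (hR1 A hA).unique ⟨h3, h1⟩ ⟨h2, hr⟩
  refine ⟨ρ, fun x hx => (hρ x hx).1, hid, ?_, ?_⟩
  · intro x hx y hy hxy
    obtain ⟨-, A, hA, h2, h3⟩ := hρ x hx
    obtain ⟨-, B, hB, h5, h6⟩ := hρ y hy
    rw [← hxy] at h6
    have := huniq A hA B hB _ h3 h6
    subst this
    exact hfol A hA x h2 y h5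
  · intro p q
    constructor
    · rintro ⟨hne, hp, hq, A, hA, B, hB, -, hpA, hqB, u, hu, v, hv, huv⟩
      refine ⟨hne, u, v, ?_, ?_, huv⟩
      · exact (hR1 A hA).unique ⟨hblk A hA u hu, (hρ u (hsub A hA hu)).1⟩ ⟨hpA, hp⟩
      · exact (hR1 B hB).unique ⟨hblk B hB v hv, (hρ v (hsub B hB hv)).1⟩ ⟨hqB, hq⟩
    · rintro ⟨hne, u, v, rfl, rfl, huv⟩
      obtain ⟨hu, hv⟩ := G.mem_of_adj _ _ huv
      obtain ⟨h1, A, hA, h2, h3⟩ := hρ u hu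
      obtain ⟨h4, B, hB, h5, h6⟩ := hρ v hv
      refine ⟨hne, h1, h4, A, hA, B, hB, ?_, h3, h6, u, h2, v, h5, huv⟩
      rintro rfl
      exact hne ((hR1 A hA).unique ⟨h3, h1⟩ ⟨h6, h4⟩)

/-- Foliage-equivalent vertices: an outer neighbour of one is shared, or the other is a leaf. -/
theorem FGraph.FoliageEq.outer {V : Type*} {G : FGraph V} {x u v : V} (h : G.FoliageEq x u)
    (huv : G.Adj u v) (hvx : v ≠ x) :
    G.Adj x v ∨ G.IsLeafAxil x u := by
  rcases h with rfl | h | h | ⟨-, h, -⟩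
  · exact Or.inl huv
  · exact Or.inr h
  · exact absurd (h.2 v huv) hvx
  · left
    have : v ∈ {y | G.Adj u y} \ {x} := ⟨huv, hvx⟩
    rw [← h] at this
    exact this.1

/-- Foliage Source Reduction. -/
theorem foliage_source_reduction {V : Type*} [DecidableEq V] (G G' : FGraph V)
    (P : Set (Set V)) (hP : G.IsFoliagePartition P) (R : Finset V)
    (hR1 : ∀ A ∈ P, ∃! w, w ∈ A ∧ w ∈ R)
    (hR2 : ∀ w ∈ R, ∃ A ∈ P, w ∈ A)
    (hVR : G'.verts ⊆ R) (hRV : R ⊆ G.verts)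
    (hiso : ∀ v ∈ G'.verts, ∃ w, G'.Adj v w) :
    IsVertexMinor G' G ↔ IsVertexMinor G' (G.labeling P R) := by
  obtain ⟨ρ, hρR, hid, hfol, hQ⟩ := exists_blockMap G P hP R hR1 hRV
  set Q := G.labeling P R with hQdef
  have hQv : Q.verts = R := rfl
  have inv : FolInv ρ G Q {x | ∃ y, ρ x ≠ ρ y ∧ G.Adj x y} := by
    have key : ∀ x u v, ρ x = ρ u → ρ u ≠ ρ v → (∃ y, ρ x ≠ ρ y ∧ G.Adj x y) → G.Adj u v →
        G.Adj x v := by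
      rintro x u v hxu huv ⟨y, hxy, hy⟩ hadj
      rcases (hfol x (G.mem_of_adj _ _ hy).1 u (G.mem_of_adj _ _ hadj).1 hxu).outer hadj
        (by rintro rfl; exact huv hxu.symm) with h | h
      · exact h
      · have := h.2 y hy
        subst this
        exact absurd hxu hxy
    intro x y hxy
    rw [hQ]
    constructor
    · intro h
      exact ⟨⟨y, hxy, h⟩, ⟨x, hxy.symm, G.symm _ _ h⟩, hxy, x, y, rfl, rfl, h⟩
    · rintro ⟨hx, hy, -, u, v, hu, hv, huv⟩
      have h1 : G.Adj x v := key x u v hu.symm (by rw [hu, hv]; exact hxy) hx huv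
      exact G.symm _ _ (key y v x hv.symm (by rw [hv]; exact hxy.symm) hy (G.symm _ _ h1))
  constructor
  · intro h
    obtain ⟨Q', X', hm, hv, hi⟩ := inv.steps h
    have hX : ∀ x ∈ G'.verts, x ∈ X' := by
      intro x hx
      obtain ⟨w, hw⟩ := hiso x hx
      refine ((hi x w ?_).1 hw).1
      rw [hid x (hVR hx), hid w (hVR (G'.mem_of_adj _ _ hw).2)]
      rintro rfl
      exact G'.loopless _ hw
    refine hm.trans (isVertexMinor_of_induced G' _ Q' rfl (by rw [hv]; exact hVR) ?_)
    intro x hx y hy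
    by_cases hxy : x = y
    · subst hxy
      exact iff_of_false (G'.loopless _) (Q'.loopless _)
    · have := hi x y (by rwa [hid x (hVR hx), hid y (hVR hy)])
      rw [hid x (hVR hx), hid y (hVR hy)] at this
      rw [this]
      simp [hX x hx, hX y hy]
  · intro h
    refine Relation.ReflTransGen.trans ?_ h
    classical
    obtain ⟨H', X', h1, h2, h3, -, h5⟩ := inv.fix R hid
      (R.filter fun r => ∃ q, Q.Adj r q) (Finset.filter_subset _ _) G _ (by
        intro r hr
        obtain ⟨hrR, q, hrq⟩ := Finset.mem_filter.1 hr
        obtain ⟨hne, u, v, rfl, rfl, huv⟩ := (hQ r q).1 hrq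
        have hrr := hid _ hrR
        rcases (hfol _ (hRV hrR) u (G.mem_of_adj _ _ huv).1 hrr).outer huv
          (by rintro rfl; exact hne hrr.symm) with h | h
        · exact Or.inl ⟨v, by rwa [hrr], h⟩
        · exact Or.inr ⟨u, ⟨v, hne, huv⟩, rfl, h.1⟩)
    refine Relation.ReflTransGen.trans h1
      (isVertexMinor_of_induced Q _ H' rfl (by rw [h2]; exact hRV) ?_)
    intro x hx y hy
    rw [hQv] at hx hy
    by_cases hxy : x = y
    · subst hxy
      exact iff_of_false (Q.loopless _) (H'.loopless _)
    · have := h3 x y (by rwa [hid x hx, hid y hy])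
      rw [hid x hx, hid y hy] at this
      rw [this]
      constructor
      · intro hh
        exact ⟨h5 x (Finset.mem_filter.2 ⟨hx, y, hh⟩),
          h5 y (Finset.mem_filter.2 ⟨hy, x, Q.symm _ _ hh⟩), hh⟩
      · exact fun hh => hh.2.2
end

section
/- (Target Reduction) Let G = (V,E) and G' = (V',E') be finite simple graphs with G' a vertex-minor of G, and let v ≠ w be vertices that are foliage-equivalent in both G and G'. Define G̃ as follows: if (v,w) is a leaf-axil pair in G or {v,w} is a twin pair in G, then G̃ = G \ v; if (w,v) is a leaf-axil pair in G, then G̃ = τ_w(τ_v(G)) \ v. Define G̃' analogously from G': if (v,w) is a leaf-axil pair in G' or {v,w} is a twin pair in G', then G̃' = G' \ v; if (w,v) is a leaf-axil pair in G', then G̃' = τ_w(τ_v(G')) \ v. Then G̃' is a vertex-minor of G̃. -/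
variable {V : Type*}

namespace TR

theorem gext {V : Type*} {G H : FGraph V} (h : G.verts = H.verts)
    (h2 : ∀ x y, G.Adj x y ↔ H.Adj x y) : G = H := by
  cases G; cases H
  simp only at h h2
  subst h
  congr
  funext x y
  exact propext (h2 x y)

theorem lc_adj {V : Type*} (G : FGraph V) (a x y : V) :
    (G.lc a).Adj x y ↔ ((G.Adj x y ∧ ¬(x ≠ y ∧ G.Adj a x ∧ G.Adj a y)) ∨
             ((x ≠ y ∧ G.Adj a x ∧ G.Adj a y) ∧ ¬ G.Adj x y)) := Iff.rfl

theorem del_adj {V : Type*} [DecidableEq V] (G : FGraph V) (a x y : V) :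
    (G.delete a).Adj x y ↔ (G.Adj x y ∧ x ≠ a ∧ y ≠ a) := Iff.rfl

theorem leaf_iff {V : Type*} (G : FGraph V) (l a : V) :
    G.IsLeafAxil l a ↔ G.Adj l a ∧ ∀ x, G.Adj l x → x = a := Iff.rfl

/-- Relaxed foliage relation (cut-rank at most one). -/
def Rel {V : Type*} (G : FGraph V) (v w : V) : Prop :=
  (∀ x, G.Adj v x → x = w) ∨ (∀ x, G.Adj w x → x = v) ∨
    (∀ x, x ≠ v → x ≠ w → (G.Adj v x ↔ G.Adj w x))

def NI {V : Type*} (G : FGraph V) (v : V) : Prop := ∃ x, G.Adj v x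

theorem lc_lc {V : Type*} (G : FGraph V) (a : V) : (G.lc a).lc a = G := by
  refine gext rfl fun x y => ?_
  have := G.symm
  have := G.loopless
  simp only [lc_adj]
  grind

theorem lc_del {V : Type*} [DecidableEq V] (G : FGraph V) (a v : V) (h : a ≠ v) :
    (G.lc a).delete v = (G.delete v).lc a := by
  refine gext rfl fun x y => ?_
  simp only [lc_adj, del_adj]
  grind

theorem del_del {V : Type*} [DecidableEq V] (G : FGraph V) (a v : V) :
    (G.delete a).delete v = (G.delete v).delete a := by
  refine gext ?_ fun x y => ?_
  · exact Finset.erase_right_comm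
  · simp only [del_adj]
    grind

theorem lc_leaf {V : Type*} (G : FGraph V) (a b : V) (h : ∀ x, G.Adj a x → x = b) :
    G.lc a = G := by
  refine gext rfl fun x y => ?_
  simp only [lc_adj]
  grind

theorem swap_adj {V : Type*} [DecidableEq V] (G : FGraph V) (v w x y : V)
    (hL : G.IsLeafAxil w v) : (((G.lc v).lc w).delete v).Adj x y ↔
      x ≠ v ∧ y ≠ v ∧ ((x = w ∧ y ≠ w ∧ G.Adj v y) ∨ (y = w ∧ x ≠ w ∧ G.Adj v x) ∨
        (x ≠ w ∧ y ≠ w ∧ G.Adj x y)) := by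
  have hs := G.symm
  have hl := G.loopless
  rw [leaf_iff] at hL
  obtain ⟨h1, h2⟩ := hL
  have h3 := hs _ _ h1
  have hw : ∀ x, G.Adj w x ↔ x = v := fun x => ⟨h2 x, fun h => h ▸ h1⟩
  have hw' : ∀ x, G.Adj x w ↔ x = v := fun x => ⟨fun h => h2 x (hs _ _ h), fun h => h ▸ h3⟩
  have hne : v ≠ w := fun h => hl _ (h ▸ h1)
  have e : ∀ x, (G.lc v).Adj w x ↔ (x = v ∨ (x ≠ w ∧ G.Adj v x)) := by
    intro x; simp only [lc_adj]; grind
  rw [del_adj, lc_adj, e, e, lc_adj]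
  by_cases hx : x = w
  · subst hx; grind
  · by_cases hy : y = w
    · subst hy; grind
    · have := hs x y
      grind

open Classical in
noncomputable def T {V : Type*} [DecidableEq V] (G : FGraph V) (v w : V) : FGraph V :=
  if G.IsLeafAxil w v then ((G.lc v).lc w).delete v else G.delete v

theorem T_pos {V : Type*} [DecidableEq V] {G : FGraph V} {v w : V} (h : G.IsLeafAxil w v) :
    T G v w = ((G.lc v).lc w).delete v := if_pos h

theorem T_neg {V : Type*} [DecidableEq V] {G : FGraph V} {v w : V} (h : ¬ G.IsLeafAxil w v) :
    T G v w = G.delete v := if_neg h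

theorem T_leaf {V : Type*} [DecidableEq V] {G : FGraph V} {v w : V}
    (h : ∀ x, G.Adj v x → x = w) : T G v w = G.delete v := by
  by_cases hL : G.IsLeafAxil w v
  · rw [T_pos hL, lc_leaf G v w h, lc_leaf G w v hL.2]
  · exact T_neg hL

theorem T_of {V : Type*} [DecidableEq V] {G t : FGraph V} {v w : V}
    (h : ((G.IsLeafAxil v w ∨ G.IsTwin v w) ∧ t = G.delete v) ∨
           (G.IsLeafAxil w v ∧ t = ((G.lc v).lc w).delete v)) : t = T G v w := by
  rcases h with ⟨h | h, rfl⟩ | ⟨h, rfl⟩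
  · exact (T_leaf h.2).symm
  · refine (T_neg fun hL => ?_).symm
    obtain ⟨_, h1, x, hx⟩ := h
    rw [h1] at hx
    exact hx.2 (hL.2 x hx.1)
  · exact (T_pos h).symm

theorem rel_of {V : Type*} {G : FGraph V} {v w : V} (hvw : v ≠ w) (h : G.FoliageEq v w) :
    Rel G v w ∧ NI G v ∧ NI G w := by
  rcases h with h | h | h | ⟨_, h, x, hx⟩
  · exact absurd h hvw
  · exact ⟨Or.inl h.2, ⟨w, h.1⟩, ⟨v, G.symm _ _ h.1⟩⟩
  · exact ⟨Or.inr (Or.inl h.2), ⟨w, G.symm _ _ h.1⟩, ⟨v, h.1⟩⟩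
  · refine ⟨Or.inr (Or.inr fun y hy hy' => ?_), ⟨x, hx.1⟩, ⟨x, (h ▸ hx).1⟩⟩
    have := Set.ext_iff.1 h y
    simpa [hy, hy'] using this

theorem ni_lc {V : Type*} {G : FGraph V} {v a : V} (h : NI (G.lc a) v) : NI G v := by
  obtain ⟨x, hx⟩ := h
  rw [lc_adj] at hx
  have := G.symm a v
  unfold NI
  grind

theorem ni_del {V : Type*} [DecidableEq V] {G : FGraph V} {v a : V} (h : NI (G.delete a) v) :
    NI G v := ⟨_, h.choose_spec.1⟩

theorem rel_del {V : Type*} [DecidableEq V] {G : FGraph V} {v w a : V}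
    (h : Rel G v w) : Rel (G.delete a) v w := by
  unfold Rel at *
  simp only [del_adj]
  grind

theorem rel_lc {V : Type*} {G : FGraph V} {v w a : V} (hvw : v ≠ w)
    (h : Rel G v w) : Rel (G.lc a) v w := by
  have hs := G.symm
  have hl := G.loopless
  unfold Rel at *
  simp only [lc_adj]
  rcases h with h | h | h
  · by_cases h1 : a = v
    · grind
    · by_cases h2 : a = w
      · by_cases h3 : G.Adj v w
        · right; right; grind
        · left; grind
      · left; grind
  · by_cases h1 : a = w
    · grind
    · by_cases h2 : a = v
      · by_cases h3 : G.Adj v w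
        · right; right; grind
        · right; left; grind
      · right; left; grind
  · by_cases h3 : G.Adj v w
    · by_cases h1 : a = v
      · right; left; grind
      · by_cases h2 : a = w
        · left; grind
        · right; right; grind
    · have := hl v
      have := hl w
      right; right
      by_cases h1 : a = v
      · subst h1; grind
      · by_cases h2 : a = w
        · subst h2; grind
        · have := h a h1 h2
          grind

theorem leaf_lc {V : Type*} {G : FGraph V} {v w a : V} (hav : a ≠ v)
    (h : G.IsLeafAxil w v) : (G.lc a).IsLeafAxil w v := by
  have hs := G.symm
  have hl := G.loopless
  simp only [leaf_iff, lc_adj] at *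
  grind

/-- One step of the reduction, local complementation. -/
theorem step_lc {V : Type*} [DecidableEq V] {G : FGraph V} {v w a : V} (hvw : v ≠ w)
    (hR : Rel G v w) (hv : NI G v) (hw : NI G w) :
    T (G.lc a) v w = T G v w ∨ ∃ b, T (G.lc a) v w = (T G v w).lc b := by
  have hs := G.symm
  have hl := G.loopless
  by_cases hL : G.IsLeafAxil w v
  · by_cases hav : a = v
    · subst hav
      by_cases hlv : ∀ x, G.Adj a x → x = w
      · left; rw [lc_leaf G a w hlv]
      · right
        have hL' : ¬ (G.lc a).IsLeafAxil w a := by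
          simp only [leaf_iff, lc_adj] at *
          push Not at hlv
          obtain ⟨x, hx, hxw⟩ := hlv
          intro h
          have := h.2 x
          have : x ≠ a := fun e => hl a (e ▸ hx)
          grind
        refine ⟨w, ?_⟩
        rw [T_neg hL', T_pos hL, ← lc_del _ _ _ hvw.symm, lc_lc]
    · by_cases haw : a = w
      · subst haw
        left; rw [lc_leaf G a v hL.2]
      · right
        refine ⟨a, ?_⟩
        have hL' := leaf_lc hav hL
        rw [T_pos hL', T_pos hL]
        refine gext rfl fun x y => ?_
        rw [swap_adj _ _ _ _ _ hL', lc_adj (((G.lc v).lc w).delete v), swap_adj _ _ _ _ _ hL, swap_adj _ _ _ _ _ hL,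
          swap_adj _ _ _ _ _ hL]
        simp only [lc_adj]
        obtain ⟨h1, h2⟩ := hL
        have h4 : ¬ G.Adj a w := fun h => hav (h2 a (hs _ _ h))
        have h5 := hs a v
        have h6 := hs v a
        clear hR hv hw
        by_cases hx : x = w
        · subst hx; grind
        · by_cases hy : y = w
          · subst hy; grind
          · grind
  · by_cases hav : a = v
    · subst hav
      by_cases hlv : ∀ x, G.Adj a x → x = w
      · left; rw [lc_leaf G a w hlv]
      · have htw : ∀ x, x ≠ a → x ≠ w → (G.Adj a x ↔ G.Adj w x) := by
          rcases hR with h | h | h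
          · exact absurd h hlv
          · exfalso
            obtain ⟨x, hx⟩ := hw
            exact hL ⟨h x hx ▸ hx, h⟩
          · exact h
        right
        refine ⟨w, ?_⟩
        by_cases hadj : G.Adj a w
        · have hL' : (G.lc a).IsLeafAxil w a := by
            simp only [leaf_iff, lc_adj]
            grind
          rw [T_pos hL', T_neg hL, lc_lc, lc_del _ _ _ hvw.symm]
        · have hL' : ¬ (G.lc a).IsLeafAxil w a := by
            simp only [leaf_iff, lc_adj]
            grind
          rw [T_neg hL', T_neg hL]
          refine gext rfl fun x y => ?_
          simp only [lc_adj, del_adj]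
          grind
    · right
      refine ⟨a, ?_⟩
      have hL' : ¬ (G.lc a).IsLeafAxil w v := by
        intro h
        have := leaf_lc hav h
        rw [lc_lc] at this
        exact hL this
      rw [T_neg hL', T_neg hL, lc_del _ _ _ hav]

/-- One step of the reduction, deletion. -/
theorem step_del {V : Type*} [DecidableEq V] {G : FGraph V} {v w a : V} (hvw : v ≠ w)
    (hR : Rel G v w) (hv : NI (G.delete a) v) (hw : NI (G.delete a) w) :
    T (G.delete a) v w = (T G v w).delete a := by
  have hs := G.symm
  have hav : a ≠ v := fun h => hv.choose_spec.2.1 h.symm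
  have haw : a ≠ w := fun h => hw.choose_spec.2.1 h.symm
  by_cases hL : G.IsLeafAxil w v
  · have hL' : (G.delete a).IsLeafAxil w v :=
      ⟨⟨hL.1, haw.symm, hav.symm⟩, fun x hx => hL.2 x hx.1⟩
    rw [T_pos hL', T_pos hL, ← lc_del _ _ _ hav.symm, ← lc_del _ _ _ haw.symm, del_del]
  · rw [T_neg hL]
    by_cases hL' : (G.delete a).IsLeafAxil w v
    · rw [T_leaf, del_del]
      simp only [leaf_iff, del_adj, Rel] at *
      intro x hx
      have : x ≠ v := fun e => G.loopless v (e ▸ hx.1)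
      grind
    · rw [T_neg hL', del_del]

end TR

/-- Target Reduction. -/
theorem target_reduction {V : Type*} [DecidableEq V] (G G' tG tG' : FGraph V) (v w : V)
    (hvm : IsVertexMinor G' G) (hvw : v ≠ w)
    (hG : G.FoliageEq v w) (hG' : G'.FoliageEq v w)
    (htG : ((G.IsLeafAxil v w ∨ G.IsTwin v w) ∧ tG = G.delete v) ∨
           (G.IsLeafAxil w v ∧ tG = ((G.lc v).lc w).delete v))
    (htG' : ((G'.IsLeafAxil v w ∨ G'.IsTwin v w) ∧ tG' = G'.delete v) ∨
            (G'.IsLeafAxil w v ∧ tG' = ((G'.lc v).lc w).delete v)) :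
    IsVertexMinor tG' tG := by
  rw [TR.T_of htG, TR.T_of htG']
  obtain ⟨hR, -, -⟩ := TR.rel_of hvw hG
  obtain ⟨-, hv, hw⟩ := TR.rel_of hvw hG'
  clear hG hG' htG htG'
  suffices h : TR.Rel G' v w ∧ (TR.NI G' v → TR.NI G' w →
      IsVertexMinor (TR.T G' v w) (TR.T G v w)) from h.2 hv hw
  clear hv hw
  induction hvm with
  | refl => exact ⟨hR, fun _ _ => Relation.ReflTransGen.refl⟩
  | @tail H K _ hst ih =>
    rcases hst with ⟨a, rfl⟩ | ⟨a, rfl⟩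
    · refine ⟨TR.rel_lc hvw ih.1, fun hv hw => ?_⟩
      have hv' := TR.ni_lc hv
      have hw' := TR.ni_lc hw
      have hm := ih.2 hv' hw'
      rcases TR.step_lc (a := a) hvw ih.1 hv' hw' with h | ⟨b, h⟩
      · rw [h]; exact hm
      · exact Relation.ReflTransGen.tail hm (Or.inl ⟨b, h⟩)
    · refine ⟨TR.rel_del ih.1, fun hv hw => ?_⟩
      have hm := ih.2 (TR.ni_del hv) (TR.ni_del hw)
      exact Relation.ReflTransGen.tail hm (Or.inr ⟨a, TR.step_del hvw ih.1 hv hw⟩)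
end

section
/- Let n ≥ 3 and let L_n be the line graph on vertices {1, ..., n} with edges {i, i+1} for 1 ≤ i ≤ n-1. Let a_1 < b < a_2 be vertices of L_n. Then the graph on vertex set {a_1, a_2, b} whose only edge is {a_1, a_2} (a Bell pair on {a_1,a_2} together with the isolated vertex b) is not a vertex-minor of L_n. -/
variable {V : Type*}

/-- The line graph `L_n` on vertices `{1, ..., n}` with edges `{i, i+1}`. -/
def lineGraph (n : ℕ) : FGraph ℕ where
  verts := Finset.Icc 1 n
  Adj x y := x ∈ Finset.Icc 1 n ∧ y ∈ Finset.Icc 1 n ∧ (y = x + 1 ∨ x = y + 1)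
  symm := by rintro x y ⟨hx, hy, hc⟩; exact ⟨hy, hx, hc.symm⟩
  loopless := by rintro x ⟨_, _, h | h⟩ <;> omega
  mem_of_adj := by rintro x y ⟨hx, hy, _⟩; exact ⟨hx, hy⟩

/-- The ring (cycle) graph `R_n` on vertices `{1, ..., n}`. -/
def ringGraph (n : ℕ) : FGraph ℕ where
  verts := Finset.Icc 1 n
  Adj x y := x ≠ y ∧ x ∈ Finset.Icc 1 n ∧ y ∈ Finset.Icc 1 n ∧
    (y = x + 1 ∨ x = y + 1 ∨ (x = n ∧ y = 1) ∨ (x = 1 ∧ y = n))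
  symm := by rintro x y ⟨hne, hx, hy, hc⟩; exact ⟨hne.symm, hy, hx, by tauto⟩
  loopless := by rintro x ⟨hne, _⟩; exact hne rfl
  mem_of_adj := by rintro x y ⟨_, hx, hy, _⟩; exact ⟨hx, hy⟩

/-- The successor of position `i` along the cycle `1, 2, ..., n, 1`. -/
def cnext (n i : ℕ) : ℕ := if i = n then 1 else i + 1

/-- A Bell pair on `{a1, a2}` together with the isolated vertex `b`. -/
def bell1 {V : Type*} [DecidableEq V] (a1 a2 b : V) : FGraph V where
  verts := {a1, a2, b}
  Adj x y := x ≠ y ∧ ((x = a1 ∧ y = a2) ∨ (x = a2 ∧ y = a1))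
  symm := by rintro x y ⟨hne, hc⟩; exact ⟨hne.symm, by tauto⟩
  loopless := by rintro x ⟨hne, _⟩; exact hne rfl
  mem_of_adj := by
    rintro x y ⟨_, (⟨hx, hy⟩ | ⟨hx, hy⟩)⟩ <;> subst hx <;> subst hy <;>
      simp [Finset.mem_insert]

/-- Two Bell pairs, on `{a1, a2}` and on `{b1, b2}`. -/
def bell2 {V : Type*} [DecidableEq V] (a1 a2 b1 b2 : V) : FGraph V where
  verts := {a1, a2, b1, b2}
  Adj x y := x ≠ y ∧ ((x = a1 ∧ y = a2) ∨ (x = a2 ∧ y = a1) ∨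
                      (x = b1 ∧ y = b2) ∨ (x = b2 ∧ y = b1))
  symm := by rintro x y ⟨hne, hc⟩; exact ⟨hne.symm, by tauto⟩
  loopless := by rintro x ⟨hne, _⟩; exact hne rfl
  mem_of_adj := by
    rintro x y ⟨_, (⟨hx, hy⟩ | ⟨hx, hy⟩ | ⟨hx, hy⟩ | ⟨hx, hy⟩)⟩ <;> subst hx <;> subst hy <;>
      simp [Finset.mem_insert]

open Classical in
/-- The `Z`-part of the stabilizer element with `X`-part `x`. -/
noncomputable def zpart (G : FGraph V) (x : V → ZMod 2) (v : V) : ZMod 2 :=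
  ∑ u ∈ G.verts, if G.Adj v u then x u else 0

/-- Local commutation form at the vertex `v`. -/
noncomputable def omg (G : FGraph V) (x y : V → ZMod 2) (v : V) : ZMod 2 :=
  x v * zpart G y v + y v * zpart G x v

/-- The `X`-part is supported on the vertex set. -/
def Supp (G : FGraph V) (x : V → ZMod 2) : Prop := ∀ v, v ∉ G.verts → x v = 0

/-- The invariant carried backwards along vertex-minor steps. -/
def Phi (a1 a2 b : V) (G : FGraph V) : Prop :=
  ∃ s t r : V → ZMod 2, Supp G s ∧ Supp G t ∧ Supp G r ∧
    (∀ v, omg G s t v = 0) ∧ (∀ v, omg G s r v = 0) ∧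
    (∀ v, v ≠ a1 → v ≠ a2 → omg G t r v = 0) ∧
    omg G t r a1 = 1 ∧ omg G t r a2 = 1 ∧ ¬ (s b = 0 ∧ zpart G s b = 0)

lemma zpart_nonmem (G : FGraph V) (x : V → ZMod 2) (v : V) (h : v ∉ G.verts) :
    zpart G x v = 0 := by
  unfold zpart
  apply Finset.sum_eq_zero
  intro u _
  rw [if_neg (fun hh => h (G.mem_of_adj _ _ hh).1)]

/-- Transport of stabilizer elements under local complementation. -/
noncomputable def lcx [DecidableEq V] (G : FGraph V) (a : V) (x : V → ZMod 2) : V → ZMod 2 :=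
  fun v => x v + if v = a then zpart G x a else 0

lemma zpart_add_single [DecidableEq V] (G : FGraph V) (a : V) (x : V → ZMod 2) (c : ZMod 2)
    (v : V) [Decidable (G.Adj v a)] :
    zpart G (fun u => x u + if u = a then c else 0) v
      = zpart G x v + if G.Adj v a then c else 0 := by
  classical
  unfold zpart
  have : ∀ u ∈ G.verts, (if G.Adj v u then (x u + if u = a then c else 0) else 0)
      = (if G.Adj v u then x u else 0) + (if u = a then (if G.Adj v a then c else 0) else 0) := by
    intro u _
    by_cases h : u = a
    · subst h; by_cases h' : G.Adj v u <;> simp [h']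
    · simp [h]
  rw [Finset.sum_congr rfl this, Finset.sum_add_distrib, Finset.sum_ite_eq']
  congr 1
  by_cases h : G.Adj v a
  · simp [h, (G.mem_of_adj _ _ h).2]
  · simp [h]

lemma zpart_lc_not (G : FGraph V) (a : V) (x : V → ZMod 2) (v : V) (h : ¬ G.Adj a v) :
    zpart (G.lc a) x v = zpart G x v := by
  classical
  unfold zpart
  apply Finset.sum_congr rfl
  intro u _
  simp [FGraph.lc, h]

lemma zpart_lc_adj (G : FGraph V) (a : V) (x : V → ZMod 2) (v : V) (h : G.Adj a v) :
    zpart (G.lc a) x v = zpart G x v + zpart G x a + x v := by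
  classical
  have hv := (G.mem_of_adj _ _ h).2
  have e : x v = ∑ u ∈ G.verts, if u = v then x u else 0 := by
    rw [Finset.sum_ite_eq']; simp [hv]
  rw [e]
  unfold zpart
  rw [← Finset.sum_add_distrib, ← Finset.sum_add_distrib]
  apply Finset.sum_congr rfl
  intro u _
  have c2 : x u + x u = 0 := CharTwo.add_self_eq_zero _
  by_cases h1 : u = v
  · subst h1
    simp [FGraph.lc, h, G.loopless, c2]
  · have h1' : ¬ v = u := fun q => h1 q.symm
    by_cases h2 : G.Adj v u <;> by_cases h3 : G.Adj a u <;>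
      simp [FGraph.lc, h, h1, h1', h2, h3, c2]

lemma lc_elem [DecidableEq V] (G : FGraph V) (a : V) (x : V → ZMod 2) (v : V) :
    (v = a ∧ lcx G a x v = x v + zpart (G.lc a) x v ∧ zpart G (lcx G a x) v = zpart (G.lc a) x v) ∨
    (G.Adj a v ∧ v ≠ a ∧ lcx G a x v = x v ∧
      zpart G (lcx G a x) v = zpart (G.lc a) x v + x v) ∨
    (¬ G.Adj a v ∧ v ≠ a ∧ lcx G a x v = x v ∧ zpart G (lcx G a x) v = zpart (G.lc a) x v) := by
  classical
  have key : zpart G (lcx G a x) v = zpart G x v + if G.Adj v a then zpart G x a else 0 :=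
    zpart_add_single G a x _ v
  by_cases hva : v = a
  · left
    subst hva
    rw [key, zpart_lc_not G v x v (G.loopless v)]
    simp [G.loopless, lcx]
  · right
    by_cases h : G.Adj a v
    · left
      refine ⟨h, hva, by simp [lcx, hva], ?_⟩
      rw [key, zpart_lc_adj G a x v h, if_pos (G.symm _ _ h), add_assoc _ (x v),
        CharTwo.add_self_eq_zero, add_zero]
    · right
      refine ⟨h, hva, by simp [lcx, hva], ?_⟩
      rw [key, zpart_lc_not G a x v h, if_neg (fun q => h (G.symm _ _ q)), add_zero]

lemma omg_lc [DecidableEq V] (G : FGraph V) (a : V) (x y : V → ZMod 2) (v : V) :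
    omg G (lcx G a x) (lcx G a y) v = omg (G.lc a) x y v := by
  unfold omg
  generalize hx : zpart (G.lc a) x v = p
  generalize hy : zpart (G.lc a) y v = q
  have c2 : ∀ z : ZMod 2, z + z = 0 := CharTwo.add_self_eq_zero
  rcases lc_elem G a x v with ⟨h, h1, h2⟩ | ⟨h, h', h1, h2⟩ | ⟨h, h', h1, h2⟩ <;>
  rcases lc_elem G a y v with ⟨k, k1, k2⟩ | ⟨k, k', k1, k2⟩ | ⟨k, k', k1, k2⟩ <;>
  first
  | contradiction
  | (rw [h1, h2, k1, k2, hx, hy]; done)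
  | (rw [h1, h2, k1, k2, hx, hy]
     generalize x v = c
     generalize y v = d
     clear h1 h2 k1 k2 hx hy
     revert p q c d
     decide)

lemma Phi_lc [DecidableEq V] {a1 a2 b : V} (G : FGraph V) (a : V)
    (h : Phi a1 a2 b (G.lc a)) : Phi a1 a2 b G := by
  obtain ⟨s, t, r, hs, ht, hr, A, B, C, D, E, F⟩ := h
  have su : ∀ x, Supp (G.lc a) x → Supp G (lcx G a x) := by
    intro x hx v hv
    have h0 : x v = 0 := hx v hv
    unfold lcx
    by_cases q : v = a
    · subst q; simp [h0, zpart_nonmem G x v hv]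
    · simp [q, h0]
  refine ⟨lcx G a s, lcx G a t, lcx G a r, su _ hs, su _ ht, su _ hr, ?_⟩
  simp only [omg_lc]
  refine ⟨A, B, C, D, E, ?_⟩
  rintro ⟨f1, f2⟩
  apply F
  rcases lc_elem G a s b with ⟨h, h1, h2⟩ | ⟨h, h', h1, h2⟩ | ⟨h, h', h1, h2⟩
  · rw [h2] at f2; rw [h1, f2, add_zero] at f1; exact ⟨f1, f2⟩
  · rw [h1] at f1; rw [h2, f1, add_zero] at f2; exact ⟨f1, f2⟩
  · rw [h1] at f1; rw [h2] at f2; exact ⟨f1, f2⟩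

lemma zpart_delete [DecidableEq V] (G : FGraph V) (w : V) (x : V → ZMod 2)
    (hx : x w = 0) (v : V) (hv : v ≠ w) : zpart (G.delete w) x v = zpart G x v := by
  classical
  unfold zpart
  have : (G.delete w).verts = G.verts.erase w := rfl
  rw [this]
  have h0 : (if G.Adj v w then x w else 0) = 0 := by simp [hx]
  rw [← Finset.sum_erase (f := fun u => if G.Adj v u then x u else 0) G.verts h0]
  apply Finset.sum_congr rfl
  intro u hu
  simp [FGraph.delete, hv, Finset.ne_of_mem_erase hu]

lemma Phi_delete [DecidableEq V] {a1 a2 b : V} (G : FGraph V) (w : V)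
    (h : Phi a1 a2 b (G.delete w)) : Phi a1 a2 b G := by
  obtain ⟨s, t, r, hs, ht, hr, A, B, C, D, E, F⟩ := h
  have hw : w ∉ (G.delete w).verts := by simp [FGraph.delete]
  have su : ∀ x, Supp (G.delete w) x → Supp G x := by
    intro x hx v hv
    exact hx v (fun q => hv (Finset.mem_of_mem_erase q))
  have om : ∀ x y, Supp (G.delete w) x → Supp (G.delete w) y → ∀ v,
      omg G x y v = omg (G.delete w) x y v := by
    intro x y hx hy v
    unfold omg
    by_cases q : v = w
    · subst q; simp [hx v hw, hy v hw]
    · rw [zpart_delete G w x (hx w hw) v q, zpart_delete G w y (hy w hw) v q]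
  refine ⟨s, t, r, su _ hs, su _ ht, su _ hr, ?_⟩
  simp only [om s t hs ht, om s r hs hr, om t r ht hr]
  refine ⟨A, B, C, D, E, ?_⟩
  rintro ⟨f1, f2⟩
  apply F
  refine ⟨f1, ?_⟩
  by_cases q : b = w
  · subst q; exact zpart_nonmem _ _ _ hw
  · rw [zpart_delete G w s (hs w hw) b q]; exact f2

lemma Phi_bell [DecidableEq V] (a1 a2 b : V) (h1 : a1 ≠ b) (h2 : b ≠ a2) (h3 : a1 ≠ a2) :
    Phi a1 a2 b (bell1 a1 a2 b) := by
  classical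
  have hz : ∀ c ∈ (bell1 a1 a2 b).verts, ∀ v, zpart (bell1 a1 a2 b) (fun u => if u = c then 1 else 0) v
      = if (bell1 a1 a2 b).Adj v c then 1 else 0 := by
    intro c hc v
    unfold zpart
    rw [Finset.sum_eq_single c]
    · simp
    · intro u _ hu; simp [hu]
    · intro q; exact absurd hc q
  have m1 : a1 ∈ (bell1 a1 a2 b).verts := by simp [bell1]
  have m2 : a2 ∈ (bell1 a1 a2 b).verts := by simp [bell1]
  have m3 : b ∈ (bell1 a1 a2 b).verts := by simp [bell1]
  have su : ∀ c ∈ (bell1 a1 a2 b).verts, Supp (bell1 a1 a2 b) (fun u => if u = c then 1 else 0) := by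
    intro c hc v hv
    have : v ≠ c := fun q => hv (q ▸ hc)
    simp [this]
  refine ⟨fun u => if u = b then 1 else 0, fun u => if u = a1 then 1 else 0,
    fun u => if u = a2 then 1 else 0, su _ m3, su _ m1, su _ m2, ?_⟩
  unfold omg
  simp only [hz _ m1, hz _ m2, hz _ m3]
  refine ⟨?_, ?_, ?_, ?_, ?_, ?_⟩
  · intro v; by_cases q : v = b <;> simp [bell1, q, h1, h2, h3, h1.symm, h2.symm, h3.symm]
  · intro v; by_cases q : v = b <;> simp [bell1, q, h1, h2, h3, h1.symm, h2.symm, h3.symm]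
  · intro v q1 q2; simp [q1, q2]
  · simp [bell1, h3]
  · simp [bell1, h3, h3.symm]
  · simp

lemma zpart_line (n : ℕ) (x : ℕ → ZMod 2) (hx : Supp (lineGraph n) x) (k : ℕ) (hk : k + 1 ≤ n) :
    zpart (lineGraph n) x (k + 1) = x k + x (k + 2) := by
  classical
  have hv : ∀ v, v ∈ (lineGraph n).verts ↔ 1 ≤ v ∧ v ≤ n := by
    intro v; simp [lineGraph]
  have e : ∀ c, x c = ∑ u ∈ (lineGraph n).verts, if u = c then x u else 0 := by
    intro c
    rw [Finset.sum_ite_eq']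
    by_cases q : c ∈ (lineGraph n).verts
    · simp [q]
    · simp [q, hx c q]
  rw [e k, e (k + 2)]
  unfold zpart
  rw [← Finset.sum_add_distrib]
  apply Finset.sum_congr rfl
  intro u hu
  rw [hv] at hu
  have ha : (lineGraph n).Adj (k + 1) u ↔ (u = k ∨ u = k + 2) := by
    simp only [lineGraph, Finset.mem_Icc]; omega
  by_cases q1 : u = k
  · have q2 : u ≠ k + 2 := by omega
    rw [if_pos (ha.2 (Or.inl q1)), if_pos q1, if_neg q2, add_zero]
  · by_cases q2 : u = k + 2
    · rw [if_pos (ha.2 (Or.inr q2)), if_neg q1, if_pos q2, zero_add]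
    · rw [if_neg (fun q => (ha.1 q).elim q1 q2), if_neg q1, if_neg q2, add_zero]

/-- Partial symplectic sums telescope along the line. -/
lemma det_step (n : ℕ) (x y : ℕ → ZMod 2) (hx : Supp (lineGraph n) x)
    (hy : Supp (lineGraph n) y) (k : ℕ) (hk : k + 1 ≤ n) :
    x (k + 1) * y (k + 2) + y (k + 1) * x (k + 2)
      = (x k * y (k + 1) + y k * x (k + 1)) + omg (lineGraph n) x y (k + 1) := by
  unfold omg
  rw [zpart_line n x hx k hk, zpart_line n y hy k hk]
  generalize x k = a
  generalize x (k + 1) = b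
  generalize x (k + 2) = c
  generalize y k = d
  generalize y (k + 1) = e
  generalize y (k + 2) = f
  revert a b c d e f
  decide

lemma Phi_line (n a1 b a2 : ℕ)
    (h1 : 1 ≤ a1) (h2 : a1 < b) (h3 : b < a2) (h4 : a2 ≤ n) :
    ¬ Phi a1 a2 b (lineGraph n) := by
  rintro ⟨s, t, r, hs, ht, hr, A, B, C, D, E, F⟩
  have z0 : ∀ x, Supp (lineGraph n) x → x 0 = 0 := fun x hx => hx 0 (by simp [lineGraph])
  have dz : ∀ x y, Supp (lineGraph n) x → Supp (lineGraph n) y → ∀ m, m ≤ n →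
      (∀ v, v ≤ m → omg (lineGraph n) x y v = 0) → x m * y (m + 1) + y m * x (m + 1) = 0 := by
    intro x y hx hy m
    induction m with
    | zero => intro _ _; simp [z0 x hx, z0 y hy]
    | succ k ih =>
      intro hk hv
      rw [det_step n x y hx hy k hk, ih (by omega) (fun v q => hv v (by omega)),
        hv (k + 1) le_rfl, add_zero]
  have d1 : ∀ j, a1 + j < a2 → t (a1 + j) * r (a1 + j + 1) + r (a1 + j) * t (a1 + j + 1) = 1 := by
    intro j
    induction j with
    | zero =>
      intro _
      obtain ⟨k, rfl⟩ : ∃ k, a1 = k + 1 := ⟨a1 - 1, by omega⟩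
      have := det_step n t r ht hr k (by omega)
      rw [dz t r ht hr k (by omega) (fun v q => C v (by omega) (by omega)), D, zero_add] at this
      exact this
    | succ j ih =>
      intro hj
      have := det_step n t r ht hr (a1 + j) (by omega)
      rw [ih (by omega), C _ (by omega) (by omega), add_zero] at this
      exact this
  have key : ∀ k, a1 ≤ k → k < a2 → s k = 0 ∧ s (k + 1) = 0 := by
    intro k hk hk'
    obtain ⟨j, rfl⟩ := Nat.exists_eq_add_of_le hk
    have e1 := d1 j hk'
    have e2 := dz s t hs ht (a1 + j) (by omega) (fun v _ => A v)
    have e3 := dz s r hs hr (a1 + j) (by omega) (fun v _ => B v)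
    revert e1 e2 e3
    generalize s (a1 + j) = a
    generalize s (a1 + j + 1) = b
    generalize t (a1 + j) = c
    generalize t (a1 + j + 1) = d
    generalize r (a1 + j) = e
    generalize r (a1 + j + 1) = f
    revert a b c d e f
    decide
  apply F
  obtain ⟨k, rfl⟩ : ∃ k, b = k + 1 := ⟨b - 1, by omega⟩
  refine ⟨(key (k + 1) (by omega) h3).1, ?_⟩
  rw [zpart_line n s hs k (by omega), (key k (by omega) (by omega)).1,
    (key (k + 1) (by omega) h3).2, add_zero]

/-- a Bell pair `{a1, a2}` together with an isolated qubit `b` with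
`a1 < b < a2` cannot be extracted from the line graph `L_n`. -/
theorem bell1_not_vertexMinor_line (n a1 b a2 : ℕ) (hn : 3 ≤ n)
    (h1 : 1 ≤ a1) (h2 : a1 < b) (h3 : b < a2) (h4 : a2 ≤ n) :
    ¬ IsVertexMinor (bell1 a1 a2 b) (lineGraph n) := by
  intro h
  apply Phi_line n a1 b a2 h1 h2 h3 h4
  have hb := Phi_bell a1 a2 b (by omega) (by omega) (by omega)
  unfold IsVertexMinor at h
  generalize lineGraph n = G at h ⊢
  induction h using Relation.ReflTransGen.head_induction_on with
  | refl => exact hb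
  | head hstep _ ih =>
    rcases hstep with ⟨a, rfl⟩ | ⟨v, rfl⟩
    · exact Phi_lc _ _ ih
    · exact Phi_delete _ _ ih
end

section
/- Let n ≥ 4 and let R_n be the ring (cycle) graph on vertices {1, ..., n}. Let a_1, a_2, b_1, b_2 be four distinct vertices such that a_1, a_2, b_1 are consecutive on the cycle in that cyclic order. Then the graph on vertex set {a_1, a_2, b_1, b_2} whose only edges are {a_1, a_2} and {b_1, b_2} (two Bell pairs) is not a vertex-minor of R_n. -/
variable {V : Type*}

open Classical in
/-- Neighborhood sum over `ZMod 2` of a vector `x` at the vertex `u`. -/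
noncomputable def nbSum (G : FGraph ℕ) (x : ℕ → ZMod 2) (u : ℕ) : ZMod 2 :=
  ∑ w ∈ G.verts, if G.Adj u w then x w else 0

/-- The invariant: stabilizer elements trivial at `p` and `q` do not realize all Paulis at `r`. -/
def NotFull (p q r : ℕ) (G : FGraph ℕ) : Prop :=
  ∃ α β : ZMod 2, (α ≠ 0 ∨ β ≠ 0) ∧ ∀ x : ℕ → ZMod 2, x p = 0 → x q = 0 →
    nbSum G x p = 0 → nbSum G x q = 0 → α * x r + β * nbSum G x r = 0

open Classical in
lemma nbSum_update (G : FGraph ℕ) (x : ℕ → ZMod 2) (a u : ℕ) (t : ZMod 2) :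
    nbSum G (fun w => x w + if w = a then t else 0) u
      = nbSum G x u + if G.Adj u a then t else 0 := by
  unfold nbSum
  have h : ∀ w, (if G.Adj u w then (x w + if w = a then t else 0) else 0)
      = (if G.Adj u w then x w else 0) + (if w = a then (if G.Adj u a then t else 0) else 0) := by
    intro w
    by_cases hw : w = a
    · subst hw; by_cases h : G.Adj u w <;> simp [h]
    · simp [hw]
  simp only [h, Finset.sum_add_distrib, Finset.sum_ite_eq']
  by_cases ha : G.Adj u a
  · simp [ha, (G.mem_of_adj _ _ ha).2]
  · simp [ha]

open Classical in
lemma nbSum_lc (G : FGraph ℕ) (x : ℕ → ZMod 2) (a u : ℕ) :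
    nbSum (G.lc a) x u
      = nbSum G x u + if G.Adj u a then nbSum G x a + x u else 0 := by
  have key : ∀ w, (if (G.lc a).Adj u w then x w else 0)
      = (if G.Adj u w then x w else 0) + (if G.Adj u a then
        ((if G.Adj a w then x w else 0) + (if w = u then x u else 0)) else 0) := by
    intro w
    have e2 : ∀ z : ZMod 2, z + z = 0 := fun z => CharTwo.add_self_eq_zero z
    have hs : G.Adj u a ↔ G.Adj a u := ⟨G.symm _ _, G.symm _ _⟩
    rw [hs]
    by_cases hw : w = u
    · subst hw
      have := G.loopless w
      by_cases h1 : G.Adj a w <;> simp [FGraph.lc, this, h1, e2]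
    · have hw' : u ≠ w := fun h => hw h.symm
      by_cases h1 : G.Adj a u <;> by_cases h2 : G.Adj a w <;> by_cases h3 : G.Adj u w <;>
        simp [FGraph.lc, hw, hw', h1, h2, h3, e2]
  have hv : (G.lc a).verts = G.verts := rfl
  unfold nbSum
  rw [hv, Finset.sum_congr rfl (fun w _ => key w), Finset.sum_add_distrib]
  congr 1
  by_cases ha : G.Adj u a
  · simp [ha, Finset.sum_add_distrib, (G.mem_of_adj _ _ ha).1]
  · simp [ha]

lemma notFull_lc {p q r : ℕ} {G : FGraph ℕ} (a : ℕ) (h : NotFull p q r G) :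
    NotFull p q r (G.lc a) := by
  classical
  obtain ⟨α, β, hne, h⟩ := h
  -- the pulled back vector
  have e2 : ∀ z : ZMod 2, z + z = 0 := fun z => CharTwo.add_self_eq_zero z
  have zero : ∀ (x : ℕ → ZMod 2) (u : ℕ), x u = 0 → nbSum (G.lc a) x u = 0 →
      (x u + if u = a then nbSum G x a else 0) = 0 ∧
      nbSum G (fun w => x w + if w = a then nbSum G x a else 0) u = 0 := by
    intro x u h0 h1
    rw [nbSum_lc] at h1
    rw [nbSum_update]
    by_cases hu : u = a
    · subst hu
      simp only [G.loopless, if_false, add_zero] at h1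
      simp [h0, h1]
    · by_cases ha : G.Adj u a
      · simp only [ha, if_true, h0, add_zero] at h1
        simp [hu, h0, ha, h1]
      · simp only [ha, if_false, add_zero] at h1
        simp [hu, h0, ha, h1]
  refine ⟨if G.Adj r a then α + β else α, if r = a then α + β else β, ?_, ?_⟩
  · by_cases hr : r = a
    · subst hr
      simp only [G.loopless, if_false, if_true]
      clear h
      revert hne; revert α β; decide
    · by_cases ha : G.Adj r a
      · simp only [ha, hr, if_false, if_true]
        clear h
        revert hne; revert α β; decide
      · simpa [hr, ha] using hne
  · intro x hp hq hp' hq'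
    obtain ⟨p1, p2⟩ := zero x p hp hp'
    obtain ⟨q1, q2⟩ := zero x q hq hq'
    have := h (fun w => x w + if w = a then nbSum G x a else 0) p1 q1 p2 q2
    rw [nbSum_update] at this
    rw [nbSum_lc]
    by_cases hr : r = a
    · subst hr
      simp only [G.loopless, if_false, if_true, add_zero] at this ⊢
      rw [← this]; ring
    · by_cases ha : G.Adj r a
      · simp only [ha, hr, if_false, if_true, add_zero] at this ⊢
        rw [← this]
        linear_combination e2 (β * x r)
      · simpa [hr, ha] using this

lemma nbSum_delete (G : FGraph ℕ) (x : ℕ → ZMod 2) (v u : ℕ) (hu : u ≠ v) :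
    nbSum G (fun w => if w = v then 0 else x w) u = nbSum (G.delete v) x u := by
  classical
  unfold nbSum
  have hv : (G.delete v).verts = G.verts.erase v := rfl
  rw [hv, ← Finset.sum_subset (Finset.erase_subset v G.verts)]
  · refine Finset.sum_congr rfl fun w hw => ?_
    have := Finset.ne_of_mem_erase hw
    simp [FGraph.delete, this, hu]
  · intro w hw hw'
    have : w = v := by
      by_contra hne
      exact hw' (Finset.mem_erase.2 ⟨hne, hw⟩)
    simp [this]

lemma notFull_delete {p q r : ℕ} {G : FGraph ℕ} (v : ℕ) (hp : p ≠ v) (hq : q ≠ v) (hr : r ≠ v)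
    (h : NotFull p q r G) : NotFull p q r (G.delete v) := by
  obtain ⟨α, β, hne, h⟩ := h
  refine ⟨α, β, hne, fun x h1 h2 h3 h4 => ?_⟩
  have := h (fun w => if w = v then 0 else x w) (by simp [hp, h1]) (by simp [hq, h2])
    (by rw [nbSum_delete _ _ _ _ hp, h3]) (by rw [nbSum_delete _ _ _ _ hq, h4])
  rw [nbSum_delete _ _ _ _ hr] at this
  simpa [hr] using this

lemma notFull_of_minor {p q r : ℕ} {G H : FGraph ℕ} (h : IsVertexMinor H G)
    (hG : NotFull p q r G) : p ∈ H.verts → q ∈ H.verts → r ∈ H.verts → NotFull p q r H := by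
  induction h with
  | refl => intros; exact hG
  | tail _ hs ih =>
    rcases hs with ⟨a, rfl⟩ | ⟨v, rfl⟩
    · intro hp hq hr
      exact notFull_lc a (ih hp hq hr)
    · intro hp hq hr
      have hp := Finset.mem_erase.1 hp
      have hq := Finset.mem_erase.1 hq
      have hr := Finset.mem_erase.1 hr
      exact notFull_delete v hp.1 hq.1 hr.1 (ih hp.2 hq.2 hr.2)

/-- two Bell pairs `{a1, a2}` and `{b1, b2}`, where `a1, a2, b1` are
consecutive on the cycle in that cyclic order, cannot be extracted from the ring
graph `R_n`. -/
theorem bell2_not_vertexMinor_ring (n a1 a2 b1 b2 : ℕ) (hn : 4 ≤ n)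
    (ha1 : a1 ∈ Finset.Icc 1 n) (ha2 : a2 ∈ Finset.Icc 1 n)
    (hb1 : b1 ∈ Finset.Icc 1 n) (hb2 : b2 ∈ Finset.Icc 1 n)
    (d1 : a1 ≠ a2) (d2 : a1 ≠ b1) (d3 : a1 ≠ b2)
    (d4 : a2 ≠ b1) (d5 : a2 ≠ b2) (d6 : b1 ≠ b2)
    (hc1 : a2 = cnext n a1) (hc2 : b1 = cnext n a2) :
    ¬ IsVertexMinor (bell2 a1 a2 b1 b2) (ringGraph n) := by
  classical
  intro hm
  have hG : NotFull a1 a2 b1 (ringGraph n) := by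
    refine ⟨1, 0, by simp, fun x h1 _ _ h4 => ?_⟩
    have : nbSum (ringGraph n) x a2 = x a1 + x b1 := by
      unfold nbSum
      rw [← Finset.sum_pair d2, ← Finset.sum_filter]
      refine Finset.sum_congr ?_ fun _ _ => rfl
      ext w
      simp only [ringGraph, cnext, Finset.mem_filter, Finset.mem_Icc, Finset.mem_insert,
        Finset.mem_singleton] at *
      split_ifs at hc1 hc2 <;> omega
    rw [this, h1, zero_add] at h4
    simp [h4]
  obtain ⟨α, β, hne, h⟩ := notFull_of_minor hm hG (by simp [bell2]) (by simp [bell2])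
    (by simp [bell2])
  have s1 : ∀ x, nbSum (bell2 a1 a2 b1 b2) x a1 = x a2 := by
    intro x
    simp [nbSum, bell2, d1, d2, d3, d4, d5, d6, d1.symm, d2.symm, d3.symm, d4.symm, d5.symm,
      d6.symm]
  have s2 : ∀ x, nbSum (bell2 a1 a2 b1 b2) x a2 = x a1 := by
    intro x
    simp [nbSum, bell2, d1, d2, d3, d4, d5, d6, d1.symm, d2.symm, d3.symm, d4.symm, d5.symm,
      d6.symm]
  have s3 : ∀ x, nbSum (bell2 a1 a2 b1 b2) x b1 = x b2 := by
    intro x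
    simp [nbSum, bell2, d1, d2, d3, d4, d5, d6, d1.symm, d2.symm, d3.symm, d4.symm, d5.symm,
      d6.symm]
  simp only [s1, s2, s3] at h
  have hα := h (fun w => if w = b1 then 1 else 0) (by simp [d2]) (by simp [d4]) (by simp [d4])
    (by simp [d2])
  have hβ := h (fun w => if w = b2 then 1 else 0) (by simp [d3]) (by simp [d5]) (by simp [d5])
    (by simp [d3])
  simp [d6.symm] at hα
  simp [d6] at hβ
  simp [hα, hβ] at hne
end
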